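/- Algorithm correctness for contraction: Let M be a positroid on [n] with decorated permutation (π, col), and let j satisfy π(j) ≠ j. Define μ as follows: start with μ = π, set μ(j) = j with col'(j) = +1, set q = π(j), and for a running cyclically from j+1 while π(a) ≠ j: if q = a or q <_{a+1} π(a) <_{a+1} j, then set μ(a) = q (with col'(a) = +1 if q = a) and update q = π(a); finally at the a with π(a) = j set μ(a) = q. Then (μ, col') is the decorated permutation of the contraction M/{j}. -/

import Mathlib

open Finset

/-- Position of `a` in the cyclic (linear) order starting at `t` on `Fin n`. -/
def cval {n : ℕ} (t a : Fin n) : ℕ := ((a - t : Fin n) : ℕ)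

/-- Gale order on finsets of `Fin n` induced by the linear order with key `f`:
compare the sorted lists of keys coordinatewise. -/
def galeLEKey {n : ℕ} (f : Fin n → ℕ) (A B : Finset (Fin n)) : Prop :=
  List.Forall₂ (· ≤ ·) ((A.image f).sort (· ≤ ·)) ((B.image f).sort (· ≤ ·))

/-- Gale order `≤_t` induced by the cyclic order starting at `t`. -/
def galeLE {n : ℕ} (t : Fin n) (A B : Finset (Fin n)) : Prop :=
  galeLEKey (cval t) A B

/-- The set of maximal elements of `D` w.r.t. `≤_a` (a singleton when `D` is nonempty). -/
def cmax {n : ℕ} (a : Fin n) (D : Finset (Fin n)) : Finset (Fin n) :=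
  D.filter (fun x => ∀ y ∈ D, cval a y ≤ cval a x)

/-- The set of minimal elements of `D` w.r.t. `≤_a` (a singleton when `D` is nonempty). -/
def cmin {n : ℕ} (a : Fin n) (D : Finset (Fin n)) : Finset (Fin n) :=
  D.filter (fun x => ∀ y ∈ D, cval a x ≤ cval a y)

/-- A Grassmann necklace on `[n]`. -/
def IsGrassmannNecklace {n : ℕ} [NeZero n] (I : Fin n → Finset (Fin n)) : Prop :=
  ∀ i : Fin n,
    (i ∈ I i → ∃ j : Fin n, I (i + 1) = insert j (I i \ {i})) ∧
    (i ∉ I i → I (i + 1) = I i)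

/-- A decorated permutation: a permutation with fixed points colored by `1` or `-1`
(non-fixed points carry the dummy color `1`). -/
structure DecoratedPerm (n : ℕ) where
  π : Equiv.Perm (Fin n)
  col : Fin n → ℤ
  col_fixed : ∀ i, π i = i → col i = 1 ∨ col i = -1
  col_nonfixed : ∀ i, π i ≠ i → col i = 1

/-- The Grassmann necklace associated to a decorated permutation:
`I_r = { i : i <_r π⁻¹(i), or π(i) = i and col(i) = -1 }`. -/
def necklaceOf {n : ℕ} (P : DecoratedPerm n) : Fin n → Finset (Fin n) :=
  fun r => Finset.univ.filter
    (fun i => cval r i < cval r (P.π.symm i) ∨ (P.π i = i ∧ P.col i = -1))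

/-- The forward map from Grassmann necklaces to decorated permutations:
`P` corresponds to the necklace `I`. -/
def Corresponds {n : ℕ} [NeZero n] (I : Fin n → Finset (Fin n)) (P : DecoratedPerm n) : Prop :=
  ∀ i : Fin n,
    ((I (i + 1) = I i ∧ i ∉ I i) → (P.π i = i ∧ P.col i = 1)) ∧
    ((I (i + 1) = I i ∧ i ∈ I i) → (P.π i = i ∧ P.col i = -1)) ∧
    (∀ j : Fin n, j ≠ i → i ∈ I i → I (i + 1) = insert j (I i \ {i}) → P.π i = j)

/-- `phiSet I j a` is `{j}` if `j ∈ I_a`, and otherwise `{max_a (I_a \ I_j)}`. -/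
def phiSet {n : ℕ} (I : Fin n → Finset (Fin n)) (j a : Fin n) : Finset (Fin n) :=
  if j ∈ I a then {j} else cmax a (I a \ I j)

/-- One pass of the contraction algorithm (fuel-indexed; the loop walks `a ← a+1`). -/
def contractLoop {n : ℕ} [NeZero n] (π : Equiv.Perm (Fin n)) (j : Fin n) :
    ℕ → (Fin n → Fin n) → (Fin n → ℤ) → Fin n → Fin n →
      (Fin n → Fin n) × (Fin n → ℤ)
  | 0, μ, c, q, a => (Function.update μ a q, c)
  | fuel + 1, μ, c, q, a =>
    if π a = j then (Function.update μ a q, c)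
    else if q = a ∨ (cval (a + 1) q < cval (a + 1) (π a) ∧
                      cval (a + 1) (π a) < cval (a + 1) j) then
      contractLoop π j fuel (Function.update μ a q)
        (if q = a then Function.update c a 1 else c) (π a) (a + 1)
    else
      contractLoop π j fuel μ c q (a + 1)

/-- The contraction algorithm: output `(μ, col')` from `(π, col)` and `j`. -/
def contractAlg {n : ℕ} [NeZero n] (π : Equiv.Perm (Fin n)) (col : Fin n → ℤ) (j : Fin n) :
    (Fin n → Fin n) × (Fin n → ℤ) :=
  contractLoop π j n (Function.update (⇑π) j j) (Function.update col j 1) (π j) (j + 1)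

/-- One pass of the restriction algorithm (the loop walks `a ← a-1`). -/
def restrictLoop {n : ℕ} [NeZero n] (π : Equiv.Perm (Fin n)) (j : Fin n) :
    ℕ → (Fin n → Fin n) → (Fin n → ℤ) → Fin n → Fin n →
      (Fin n → Fin n) × (Fin n → ℤ)
  | 0, μ, c, q, a => (Function.update μ a q, c)
  | fuel + 1, μ, c, q, a =>
    if π a = j then (Function.update μ a q, c)
    else if q = a ∨ (cval a j < cval a (π a) ∧ cval a (π a) < cval a q) then
      restrictLoop π j fuel (Function.update μ a q)
        (if q = a then Function.update c a 1 else c) (π a) (a - 1)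
    else
      restrictLoop π j fuel μ c q (a - 1)

/-- The restriction algorithm: output `(μ, col')` from `(π, col)` and `j`. -/
def restrictAlg {n : ℕ} [NeZero n] (π : Equiv.Perm (Fin n)) (col : Fin n → ℤ) (j : Fin n) :
    (Fin n → Fin n) × (Fin n → ℤ) :=
  restrictLoop π j n (Function.update (⇑π) j j) (Function.update col j 1) (π j) (j - 1)

namespace PositroidContraction

theorem forall₂_le_iff_countP {l₁ l₂ : List ℕ} (h₁ : l₁.Pairwise (· ≤ ·))
    (h₂ : l₂.Pairwise (· ≤ ·)) :
    List.Forall₂ (· ≤ ·) l₁ l₂ ↔ l₁.length = l₂.length ∧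
      ∀ k, l₂.countP (· < k) ≤ l₁.countP (· < k) := by
  induction l₁ generalizing l₂ with
  | nil => cases l₂ <;> simp
  | cons a l₁ ih =>
    cases l₂ with
    | nil => simp
    | cons b l₂ =>
      rw [List.pairwise_cons] at h₁ h₂
      rw [List.forall₂_cons, ih h₁.2 h₂.2]
      simp only [List.countP_cons, List.length_cons, decide_eq_true_eq]
      constructor
      · rintro ⟨hab, hl, hc⟩
        refine ⟨by omega, fun k => ?_⟩
        have := hc k
        split_ifs <;> omega
      · rintro ⟨hl, hc⟩
        have hab : a ≤ b := by
          by_contra! hlt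
          have h := hc (b + 1)
          have h0 : l₁.countP (· < b + 1) = 0 := by
            rw [List.countP_eq_zero]
            intro x hx
            have := h₁.1 x hx
            simp only [decide_eq_true_eq]
            omega
          rw [h0, if_pos (by omega), if_neg (by omega)] at h
          omega
        refine ⟨hab, by omega, fun k => ?_⟩
        have h := hc k
        by_cases hk : b < k
        · rw [if_pos hk, if_pos (by omega)] at h
          omega
        · have h0 : l₂.countP (· < k) = 0 := by
            rw [List.countP_eq_zero]
            intro x hx
            have := h₂.1 x hx
            simp only [decide_eq_true_eq]
            omega
          omega

theorem countP_sort_image {n : ℕ} {f : Fin n → ℕ} (hf : Function.Injective f)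
    (S : Finset (Fin n)) (k : ℕ) :
    ((S.image f).sort (· ≤ ·)).countP (· < k) = #{i ∈ S | f i < k} := by
  have h : ((S.image f).sort (· ≤ ·)).countP (· < k) = #{x ∈ S.image f | x < k} := by
    rw [← Multiset.coe_countP, Finset.sort_eq, Multiset.countP_eq_card_filter]
    rfl
  rw [h, Finset.filter_image, Finset.card_image_of_injective _ hf]

theorem cval_lt {n : ℕ} (t a : Fin n) : cval t a < n := (a - t).2

theorem cval_injective {n : ℕ} (t : Fin n) : Function.Injective (cval t) := by
  intro a b h
  have : NeZero n := ⟨by have := a.2; omega⟩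
  simpa using Fin.ext h

theorem galeLE_iff {n : ℕ} (t : Fin n) (A B : Finset (Fin n)) :
    galeLE t A B ↔ #A = #B ∧ ∀ k, #{i ∈ B | cval t i < k} ≤ #{i ∈ A | cval t i < k} := by
  rw [galeLE, galeLEKey, forall₂_le_iff_countP (Finset.pairwise_sort _ _)
    (Finset.pairwise_sort _ _)]
  simp only [countP_sort_image (cval_injective t), Finset.length_sort,
    Finset.card_image_of_injective _ (cval_injective t)]

/-- The arcs `a ↦ π a`, other than coloops, that run clockwise inside the cyclic interval of
length `k` starting at `t`. -/
def nullity {n : ℕ} (P : DecoratedPerm n) (t : Fin n) (k : ℕ) : ℕ :=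
  #{a | cval t (P.π a) < k ∧ cval t a ≤ cval t (P.π a) ∧ ¬(P.π a = a ∧ P.col a = -1)}

theorem nullity_eq {n : ℕ} (P : DecoratedPerm n) (t : Fin n) (k : ℕ) :
    nullity P t k = #{i ∈ (necklaceOf P t)ᶜ | cval t i < k} := by
  refine Finset.card_bij (fun a _ => P.π a) ?_ (fun _ _ _ _ h => P.π.injective h) ?_
  · intro a ha
    simp only [necklaceOf, Finset.mem_filter, Finset.mem_univ, true_and, Finset.mem_compl,
      Equiv.symm_apply_apply, EmbeddingLike.apply_eq_iff_eq] at ha ⊢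
    refine ⟨?_, ha.1⟩
    rintro (h | ⟨h, h'⟩)
    · omega
    · exact ha.2.2 ⟨h, by rwa [h] at h'⟩
  · intro i hi
    refine ⟨P.π.symm i, ?_, by simp⟩
    simp only [necklaceOf, Finset.mem_filter, Finset.mem_univ, true_and, Finset.mem_compl,
      Equiv.apply_symm_apply, not_or, not_lt] at hi ⊢
    refine ⟨hi.2, hi.1.1, ?_⟩
    rintro ⟨h, h'⟩
    rw [← h] at h'
    exact hi.1.2 ⟨by rw [P.π.eq_symm_apply] at h; exact h, h'⟩

theorem card_compl_filter {n : ℕ} (S : Finset (Fin n)) (t : Fin n) (k : ℕ) :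
    #{i ∈ Sᶜ | cval t i < k} + #{i ∈ S | cval t i < k} = #{i : Fin n | cval t i < k} := by
  rw [← Finset.card_union_of_disjoint (Finset.disjoint_filter_filter disjoint_compl_left),
    ← Finset.filter_union, Finset.union_comm, Finset.union_compl]

theorem galeLE_necklaceOf_iff {n : ℕ} (P : DecoratedPerm n) (t : Fin n) (H : Finset (Fin n)) :
    galeLE t (necklaceOf P t) H ↔
      nullity P t n = #Hᶜ ∧ ∀ k ≤ n, nullity P t k ≤ #{i ∈ Hᶜ | cval t i < k} := by
  have hn : nullity P t n = #(necklaceOf P t)ᶜ := by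
    rw [nullity_eq, Finset.filter_true_of_mem fun i _ => cval_lt t i]
  rw [galeLE_iff, hn]
  have h1 := Finset.card_add_card_compl H
  have h2 := Finset.card_add_card_compl (necklaceOf P t)
  refine and_congr (by omega) ⟨fun h k _ => ?_, fun h k => ?_⟩
  · have := h k
    have h1 := card_compl_filter H t k
    have h2 := card_compl_filter (necklaceOf P t) t k
    rw [nullity_eq]
    omega
  · have hm : ∀ i : Fin n, cval t i < k ↔ cval t i < min k n := fun i => by
      have := cval_lt t i
      omega
    simp only [hm]
    have := h (min k n) (by omega)
    have h1 := card_compl_filter H t (min k n)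
    have h2 := card_compl_filter (necklaceOf P t) t (min k n)
    rw [nullity_eq] at this
    omega

/-- Position of `x` in the cyclic order on `{0, …, n - 1}` starting at `u`, where `1 ≤ u ≤ n` and
`u = n` stands for `0`. -/
def cyc (n u x : ℕ) : ℕ := if u ≤ x then x - u else x + n - u

/-- The value `p x`, with `0` unwound to `n`. -/
def unwind (n : ℕ) (p : ℕ → ℕ) (x : ℕ) : ℕ := if p x = 0 then n else p x

/-- The running maximum of the unwound values at the positions before `x`. -/
def runMax (n : ℕ) (p : ℕ → ℕ) (x : ℕ) : ℕ := (range x).sup (unwind n p)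

theorem runMax_succ (n : ℕ) (p : ℕ → ℕ) (x : ℕ) :
    runMax n p (x + 1) = max (runMax n p x) (unwind n p x) := by
  rw [runMax, Finset.range_add_one, Finset.sup_insert, sup_comm]
  rfl

theorem unwind_le_runMax {n : ℕ} {p : ℕ → ℕ} {x y : ℕ} (h : x < y) :
    unwind n p x ≤ runMax n p y :=
  Finset.le_sup (f := unwind n p) (Finset.mem_range.2 h)

theorem self_le_runMax {n : ℕ} {p : ℕ → ℕ} (hinj : Set.InjOn p (Set.Iio n)) {x : ℕ}
    (hx : x ≤ n) : x ≤ runMax n p x := by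
  by_cases h : ∃ y < x, p y = 0
  · obtain ⟨y, hy, h⟩ := h
    have := unwind_le_runMax (n := n) (p := p) hy
    rw [unwind, if_pos h] at this
    omega
  · push Not at h
    have hc := Finset.card_le_card_of_injOn (s := range x) (t := Finset.Icc 1 (runMax n p x)) p
      (fun y hy => by
        have hy := Finset.mem_range.1 hy
        have := unwind_le_runMax (n := n) (p := p) hy
        rw [unwind, if_neg (h y hy)] at this
        have := h y hy
        simp only [Finset.coe_Icc, Set.mem_Icc]
        omega)
      (hinj.mono fun y hy => by
        have := Finset.mem_range.1 hy
        exact Set.mem_Iio.2 (by omega))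
    simpa using hc

/-- In coordinates starting at the contracted element, `m` arises from `p` by shifting its running
maxima, and `c` marks the coloops. -/
structure Shifts (n : ℕ) (p m : ℕ → ℕ) (c c' : ℕ → Prop) : Prop where
  lt : ∀ x < n, p x < n
  injOn : Set.InjOn p (Set.Iio n)
  exists_zero : ∃ x < n, p x = 0
  zero_ne : p 0 ≠ 0
  map_zero : m 0 = 0
  map_pos : ∀ x, 0 < x → x < n → m x = min (runMax n p x) (unwind n p x)
  not_zero : ¬ c' 0
  iff : ∀ x, 0 < x → x < n → (c' x ↔ c x)
  fixed : ∀ x < n, c x → p x = x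

open Classical in
/-- The coordinate version of `nullity`. -/
noncomputable def arcs (n : ℕ) (p : ℕ → ℕ) (c : ℕ → Prop) (u k : ℕ) : ℕ :=
  #{x ∈ range n | cyc n u (p x) < k ∧ cyc n u x ≤ cyc n u (p x) ∧ ¬ c x}

namespace Shifts

variable {n : ℕ} {p m : ℕ → ℕ} {c c' : ℕ → Prop}

theorem m_lt (h : Shifts n p m c c') {x : ℕ} (hx : x < n) : m x < n := by
  obtain rfl | h0 := Nat.eq_zero_or_pos x
  · rw [h.map_zero]; exact hx
  · rw [h.map_pos x h0 hx]
    by_cases hp : p x = 0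
    · obtain ⟨z, hz, hz0⟩ := h.exists_zero
      rw [min_lt_iff]
      left
      rw [runMax, Finset.sup_lt_iff (by simp; omega)]
      intro y hy
      have hy := Finset.mem_range.1 hy
      rw [unwind, if_neg]
      · exact h.lt y (by omega)
      · intro hy0
        have := h.injOn (Set.mem_Iio.2 hx) (Set.mem_Iio.2 (by omega : y < n)) (hp.trans hy0.symm)
        omega
    · rw [min_lt_iff]
      right
      rw [unwind, if_neg hp]
      exact h.lt x hx

open Classical in
theorem card_arcs_Ico (h : Shifts n p m c c') {u s : ℕ} (hu : 0 < u) (hun : u ≤ n)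
    (hs : s ≤ n) :
    #{x ∈ range n | u ≤ x ∧ x ≤ m x ∧ m x < s ∧ ¬ c' x} =
      #{x ∈ range n | u ≤ x ∧ x ≤ p x ∧ p x < s ∧ ¬ c x} + if runMax n p u < s then 1 else 0 := by
  have key : ∀ r, u ≤ r → r ≤ n →
      #{x ∈ range r | u ≤ x ∧ x ≤ m x ∧ m x < s ∧ ¬ c' x} +
        (if runMax n p r < s then 1 else 0) =
      #{x ∈ range r | u ≤ x ∧ x ≤ p x ∧ p x < s ∧ ¬ c x} +
        (if runMax n p u < s then 1 else 0) := by
    intro r hr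
    induction r, hr using Nat.le_induction with
    | base =>
      intro _
      rw [Finset.filter_false_of_mem, Finset.filter_false_of_mem] <;>
      · intro x hx
        have := Finset.mem_range.1 hx
        omega
    | succ r hr ih =>
      intro hrn
      have ih := ih (by omega)
      rw [Finset.card_filter, Finset.card_filter, Finset.sum_range_succ, Finset.sum_range_succ,
        ← Finset.card_filter, ← Finset.card_filter]
      have hm := h.map_pos r (by omega) (by omega)
      have hc := h.iff r (by omega) (by omega)
      have hf := h.fixed r (by omega)
      have hq := self_le_runMax h.injOn (x := r) (by omega)
      have hq' := runMax_succ n p r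
      have hp : (p r = 0 ∧ unwind n p r = n) ∨ (0 < p r ∧ unwind n p r = p r) := by
        unfold unwind
        split_ifs <;> omega
      have hlocal : (if u ≤ r ∧ r ≤ m r ∧ m r < s ∧ ¬ c' r then 1 else 0) +
          (if runMax n p (r + 1) < s then 1 else 0) =
          (if u ≤ r ∧ r ≤ p r ∧ p r < s ∧ ¬ c r then 1 else 0) +
          (if runMax n p r < s then 1 else 0) := by
        by_cases hcr : c r
        · have := hf hcr
          simp only [hc, hcr, not_true_eq_false, and_false, if_false]
          split_ifs <;> omega
        · simp only [hc, hcr, not_false_eq_true, and_true]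
          split_ifs <;> omega
      omega
  have := key n hun le_rfl
  have hq := self_le_runMax h.injOn (x := n) le_rfl
  rw [if_neg (by omega)] at this
  omega

theorem arcs_of_le (h : Shifts n p m c c') {u k : ℕ} (hu : 0 < u) (hk : u + k ≤ n) :
    arcs n m c' u k = arcs n p c u k + if runMax n p u < u + k then 1 else 0 := by
  classical
  have e : ∀ {f : ℕ → ℕ} {d : ℕ → Prop}, (∀ x < n, f x < n) → arcs n f d u k =
      #{x ∈ range n | u ≤ x ∧ x ≤ f x ∧ f x < u + k ∧ ¬ d x} := by
    intro f d hf
    rw [arcs]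
    congr 1
    refine Finset.filter_congr fun x hx => ?_
    have hx := Finset.mem_range.1 hx
    have := hf x hx
    by_cases hd : d x
    · simp [hd]
    · simp only [hd, not_false_eq_true, and_true, cyc]
      split_ifs <;> omega
  rw [e fun x => h.m_lt, e h.lt]
  exact h.card_arcs_Ico hu (by omega) hk

theorem arcs_of_lt (h : Shifts n p m c c') {u k : ℕ} (hu : 0 < u) (hun : u ≤ n)
    (hk : n < u + k) (hkn : k ≤ n) :
    arcs n m c' u k = arcs n p c u k + 1 := by
  classical
  obtain ⟨s, hs⟩ : ∃ s, u + k = n + s := ⟨u + k - n, by omega⟩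
  have e : ∀ {f : ℕ → ℕ} {d : ℕ → Prop}, (∀ x < n, f x < n) → arcs n f d u k =
      #{x ∈ range n | u ≤ x ∧ (x ≤ f x ∨ f x < s) ∧ ¬ d x} +
      ((if f 0 < s ∧ ¬ d 0 then 1 else 0) +
      #{x ∈ range n | 1 ≤ x ∧ x ≤ f x ∧ f x < s ∧ ¬ d x}) := by
    intro f d hf
    have h0 : (if f 0 < s ∧ ¬ d 0 then 1 else 0) =
        #{x ∈ range n | x = 0 ∧ f x < s ∧ ¬ d x} := by
      rw [Finset.card_filter, Finset.sum_eq_single_of_mem 0 (by simp; omega)]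
      · simp
      · intro b _ hb
        simp [hb]
    rw [h0, arcs, Finset.card_filter, Finset.card_filter, Finset.card_filter, Finset.card_filter,
      ← Finset.sum_add_distrib, ← Finset.sum_add_distrib]
    refine Finset.sum_congr rfl fun x hx => ?_
    have hx := Finset.mem_range.1 hx
    have := hf x hx
    by_cases hd : d x
    · simp [hd]
    · simp only [hd, not_false_eq_true, and_true]
      have hcyc : (cyc n u (f x) < k ∧ cyc n u x ≤ cyc n u (f x)) ↔
          (u ≤ x ∧ (x ≤ f x ∨ f x < s)) ∨ (x < u ∧ x ≤ f x ∧ f x < s) := by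
        unfold cyc
        split_ifs <;> omega
      simp only [hcyc]
      split_ifs <;> omega
  rw [e fun x => h.m_lt, e h.lt, h.card_arcs_Ico one_pos (by omega) (by omega)]
  have hq : runMax n p 1 = p 0 := by
    simp [runMax, unwind, h.zero_ne]
  have hc0 : ¬ c 0 := fun h0 => h.zero_ne (h.fixed 0 (by omega) h0)
  have hD : ({x ∈ range n | u ≤ x ∧ (x ≤ m x ∨ m x < s) ∧ ¬ c' x} : Finset ℕ) =
      {x ∈ range n | u ≤ x ∧ (x ≤ p x ∨ p x < s) ∧ ¬ c x} := by
    refine Finset.filter_congr fun x hx => ?_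
    have hx := Finset.mem_range.1 hx
    by_cases hux : u ≤ x
    · have hm := h.map_pos x (by omega) hx
      have hq := self_le_runMax h.injOn (x := x) (by omega)
      rw [h.iff x (by omega) hx]
      have hp : (p x = 0 ∧ unwind n p x = n) ∨ (0 < p x ∧ unwind n p x = p x) := by
        unfold unwind
        split_ifs <;> omega
      by_cases hd : c x
      · simp [hd]
      · simp only [hd, not_false_eq_true, and_true]
        omega
    · simp [hux]
  simp only [hD, hq, h.map_zero, h.not_zero, hc0, not_false_eq_true, and_true]
  rw [if_pos (by omega)]
  omega

theorem arcs_uncross (h : Shifts n p m c c') {u k : ℕ} (hu : 0 < u) (hk : u + k ≤ n)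
    (hq : runMax n p u < u + k) :
    arcs n p c u k + 1 + arcs n p c n n ≤ arcs n p c u (n - u + 1) + arcs n p c n (u + k) := by
  classical
  obtain ⟨z, hz, hz0⟩ := h.exists_zero
  have hzu : u ≤ z := by
    by_contra! hlt
    have := unwind_le_runMax (n := n) (p := p) hlt
    rw [unwind, if_pos hz0] at this
    omega
  have hone : #{x ∈ range n | x = z} = 1 := by
    rw [Finset.filter_eq', if_pos (Finset.mem_range.2 hz), Finset.card_singleton]
  suffices H : arcs n p c u k + #{x ∈ range n | x = z} + arcs n p c n n ≤
      arcs n p c u (n - u + 1) + arcs n p c n (u + k) by rwa [hone] at H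
  simp only [arcs, Finset.card_filter, ← Finset.sum_add_distrib]
  refine Finset.sum_le_sum fun x hx => ?_
  have hx := Finset.mem_range.1 hx
  have hpx := h.lt x hx
  have hf := h.fixed x hx
  have hp : (p x = 0 ∧ unwind n p x = n) ∨ (0 < p x ∧ unwind n p x = p x) := by
    unfold unwind
    split_ifs <;> omega
  have hle : x < u → p x < u + k := fun hxu => by
    have := unwind_le_runMax (n := n) (p := p) hxu
    omega
  have hxz : x = z ↔ p x = 0 := ⟨fun e => e ▸ hz0, fun e =>
    h.injOn (Set.mem_Iio.2 hx) (Set.mem_Iio.2 hz) (e.trans hz0.symm)⟩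
  by_cases hd : c x
  · have := hf hd
    have : ¬ x = z := by
      intro e
      have := hxz.1 e
      omega
    simp [hd, this]
  · simp only [hd, not_false_eq_true, and_true, hxz]
    have e1 : cyc n n x = x := by unfold cyc; split_ifs <;> omega
    have e2 : cyc n n (p x) = p x := by unfold cyc; split_ifs <;> omega
    rw [e1, e2]
    by_cases hxu : u ≤ x
    · have e3 : cyc n u x = x - u := if_pos hxu
      have e4 : (u ≤ p x ∧ cyc n u (p x) = p x - u) ∨
        (p x < u ∧ cyc n u (p x) = p x + n - u) := by unfold cyc; split_ifs <;> omega
      split_ifs <;> omega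
    · have e3 : cyc n u x = x + n - u := if_neg hxu
      have e4 : (u ≤ p x ∧ cyc n u (p x) = p x - u) ∨
        (p x < u ∧ cyc n u (p x) = p x + n - u) := by unfold cyc; split_ifs <;> omega
      have := hle (by omega)
      have : p x ≠ 0 := fun e => by have := hxz.2 e; omega
      split_ifs <;> omega

end Shifts

/-- The position of `t` in the cyclic order starting at `j`, with `j` itself put at `n`. -/
def start {n : ℕ} (j t : Fin n) : ℕ := if t = j then n else cval j t

theorem start_le {n : ℕ} (j t : Fin n) : start j t ≤ n := by
  have := cval_lt j t
  unfold start
  split_ifs <;> omega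

theorem cval_eq_cyc {n : ℕ} (j t a : Fin n) : cval t a = cyc n (start j t) (cval j a) := by
  have ha := a.2
  have ht := t.2
  have hj := j.2
  have hval : ∀ x y : Fin n, cval x y = if (x : ℕ) ≤ y then (y : ℕ) - x else y + n - x := by
    intro x y
    have hx := x.2
    have hy := y.2
    unfold cval
    rw [Fin.sub_def]
    change (n - (x : ℕ) + y) % n = _
    split_ifs with h
    · rw [show n - (x : ℕ) + y = (y - x) + n by omega, Nat.add_mod_right,
        Nat.mod_eq_of_lt (by omega)]
    · rw [Nat.mod_eq_of_lt (by omega)]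
      omega
  unfold start cyc
  simp only [Fin.ext_iff, hval]
  split_ifs <;> omega

theorem card_compl_insert_filter {n : ℕ} {H : Finset (Fin n)} {j : Fin n} (hj : j ∉ H) (t : Fin n)
    (k : ℕ) : #{i ∈ Hᶜ | cval t i < k} =
      #{i ∈ (insert j H)ᶜ | cval t i < k} + if cval t j < k then 1 else 0 := by
  have h : Hᶜ = insert j (insert j H)ᶜ := by
    ext i
    by_cases hi : i = j <;> simp [hi, hj]
  rw [h, Finset.filter_insert]
  split_ifs
  · rw [Finset.card_insert_of_notMem (by simp)]
  · rfl

section Coordinates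

variable {n : ℕ} [NeZero n]

theorem cval_self (t : Fin n) : cval t t = 0 := by simp [cval]

theorem cval_eq_zero {t a : Fin n} : cval t a = 0 ↔ a = t :=
  ⟨fun h => cval_injective t (h.trans (cval_self t).symm), fun h => h ▸ cval_self t⟩

theorem cval_pos {t a : Fin n} (h : a ≠ t) : 0 < cval t a :=
  Nat.pos_of_ne_zero fun h0 => h (cval_eq_zero.1 h0)

/-- The element at position `x` in the cyclic order starting at `j`. -/
def atPos (j : Fin n) (x : ℕ) : Fin n := Fin.ofNat n x + j

theorem cval_atPos (j : Fin n) {x : ℕ} (hx : x < n) : cval j (atPos j x) = x := by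
  simp [cval, atPos, Nat.mod_eq_of_lt hx]

theorem atPos_cval (j a : Fin n) : atPos j (cval j a) = a :=
  cval_injective j (cval_atPos j (cval_lt j a))

theorem start_pos (j t : Fin n) : 0 < start j t := by
  unfold start
  split_ifs with h
  · exact Nat.pos_of_ne_zero (NeZero.ne n)
  · exact cval_pos h

theorem cval_add_one {j a : Fin n} (h : cval j a + 1 < n) : cval j (a + 1) = cval j a + 1 := by
  have e : ((a - j) + 1 : Fin n) = a + 1 - j := (add_sub_right_comm a 1 j).symm
  have h1 : ((1 : Fin n) : ℕ) = 1 := by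
    rw [Fin.val_one', Nat.mod_eq_of_lt (by omega)]
  unfold cval at h ⊢
  rw [← e, Fin.val_add, h1, Nat.mod_eq_of_lt h]

/-- A self-map of `Fin n` in coordinates starting at `j`. -/
def coord (j : Fin n) (f : Fin n → Fin n) (x : ℕ) : ℕ := cval j (f (atPos j x))

theorem coord_cval (j a : Fin n) (f : Fin n → Fin n) : coord j f (cval j a) = cval j (f a) := by
  rw [coord, atPos_cval]

/-- The coloops of a decorated permutation in coordinates starting at `j`. -/
def coloopAt (P : DecoratedPerm n) (j : Fin n) (x : ℕ) : Prop :=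
  P.π (atPos j x) = atPos j x ∧ P.col (atPos j x) = -1

theorem nullity_eq_arcs (P : DecoratedPerm n) (j t : Fin n) (k : ℕ) :
    nullity P t k = arcs n (coord j P.π) (coloopAt P j) (start j t) k := by
  classical
  rw [nullity, arcs]
  refine Finset.card_bij (fun a _ => cval j a) ?_ (fun _ _ _ _ h => cval_injective j h) ?_
  · intro a ha
    simp only [Finset.mem_filter, Finset.mem_univ, true_and, cval_eq_cyc j t] at ha
    refine Finset.mem_filter.2 ⟨Finset.mem_range.2 (cval_lt j a), ?_⟩
    simpa only [coord_cval, coloopAt, atPos_cval] using ha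
  · intro x hx
    simp only [Finset.mem_filter, Finset.mem_range] at hx
    refine ⟨atPos j x, ?_, cval_atPos j hx.1⟩
    simp only [Finset.mem_filter, Finset.mem_univ, true_and, cval_eq_cyc j t,
      cval_atPos j hx.1]
    exact hx.2

theorem coord_injOn (j : Fin n) (π : Equiv.Perm (Fin n)) : Set.InjOn (coord j π) (Set.Iio n) := by
  intro x hx y hy h
  have h := π.injective (cval_injective j h)
  rw [← cval_atPos j hx, h, cval_atPos j hy]

theorem coord_eq_zero_iff {j : Fin n} {π : Equiv.Perm (Fin n)} {x : ℕ} (hx : x < n) :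
    coord j π x = 0 ↔ x = cval j (π.symm j) := by
  rw [coord, cval_eq_zero, ← Equiv.eq_symm_apply]
  constructor
  · intro h
    rw [← h, cval_atPos j hx]
  · rintro rfl
    exact atPos_cval _ _

theorem contractLoop_spec (π : Equiv.Perm (Fin n)) (j : Fin n) (fuel : ℕ) :
    ∀ (μ : Fin n → Fin n) (c : Fin n → ℤ) (q a : Fin n), 0 < cval j a →
      cval j a ≤ cval j (π.symm j) → n ≤ fuel + cval j a →
      cval j q = runMax n (coord j π) (cval j a) → ∀ b : Fin n,
      cval j ((contractLoop π j fuel μ c q a).1 b) =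
        (if cval j a ≤ cval j b ∧ cval j b ≤ cval j (π.symm j) ∧
            runMax n (coord j π) (cval j b) < unwind n (coord j π) (cval j b) then
          runMax n (coord j π) (cval j b) else cval j (μ b)) ∧
      (contractLoop π j fuel μ c q a).2 b =
        if cval j a ≤ cval j b ∧ cval j b < cval j (π.symm j) ∧
            runMax n (coord j π) (cval j b) = cval j b then 1 else c b := by
  induction fuel with
  | zero =>
    intro μ c q a _ _ hf
    have := cval_lt j a
    omega
  | succ fuel ih =>
    intro μ c q a ha haz hf hq b
    have hzn := cval_lt j (π.symm j)
    have hqn := cval_lt j q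
    have hbn := cval_lt j b
    have hba : cval j b = cval j a ↔ b = a := (cval_injective j).eq_iff
    rw [contractLoop]
    by_cases hπ : π a = j
    · rw [if_pos hπ]
      have hz : π.symm j = a := by rw [← hπ, Equiv.symm_apply_apply]
      rw [hz]
      have hu : unwind n (coord j π) (cval j a) = n := by
        rw [unwind, if_pos]
        rw [coord_cval, hπ, cval_self]
      by_cases hb : b = a
      · subst hb
        simp only [Function.update_self, hu, ← hq]
        rw [if_pos (by omega), if_neg (by omega)]
        exact ⟨rfl, rfl⟩
      · simp only [Function.update_of_ne hb]
        rw [if_neg (by omega), if_neg (by omega)]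
        exact ⟨rfl, rfl⟩
    · rw [if_neg hπ]
      have hπ0 := cval_pos hπ
      have hπn := cval_lt j (π a)
      have hne : cval j a ≠ cval j (π.symm j) := by
        intro h
        exact hπ (by rw [cval_injective j h, Equiv.apply_symm_apply])
      have hsucc := cval_add_one (j := j) (a := a) (by omega)
      have hu : unwind n (coord j π) (cval j a) = cval j (π a) := by
        rw [unwind, coord_cval, if_neg (by omega)]
      have hmax := runMax_succ n (coord j π) (cval j a)
      have hle := self_le_runMax (coord_injOn j π) (x := cval j a) (by omega)
      have hle' := self_le_runMax (coord_injOn j π) (x := cval j a + 1) (by omega)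
      rw [hu] at hmax
      have hqa : cval j q = cval j a ↔ q = a := (cval_injective j).eq_iff
      have hcond : (q = a ∨ (cval (a + 1) q < cval (a + 1) (π a) ∧
          cval (a + 1) (π a) < cval (a + 1) j)) ↔ cval j q < cval j (π a) := by
        have hst : start j (a + 1) = cval j a + 1 := by
          rw [start, if_neg, hsucc]
          intro h
          rw [h, cval_self] at hsucc
          omega
        simp only [cval_eq_cyc j (a + 1), hst, cval_self, ← hqa, cyc]
        split_ifs <;> omega
      by_cases hs : cval j q < cval j (π a)
      · rw [if_pos (hcond.2 hs)]
        have := ih (Function.update μ a q) (if q = a then Function.update c a 1 else c) (π a)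
          (a + 1) (by omega) (by omega) (by omega) (by rw [hsucc]; omega) b
        rw [this.1, this.2, hsucc]
        by_cases hb : b = a
        · subst hb
          refine ⟨?_, ?_⟩
          · rw [Function.update_self]
            split_ifs <;> omega
          · by_cases hqb : q = b
            · have := hqa.2 hqb
              rw [if_pos hqb, Function.update_self]
              split_ifs <;> first | rfl | omega
            · have := mt hqa.1 hqb
              rw [if_neg hqb]
              split_ifs <;> first | rfl | omega
        · rw [Function.update_of_ne hb]
          have hc : (if q = a then Function.update c a 1 else c) b = c b := by
            split_ifs
            · exact Function.update_of_ne hb _ _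
            · rfl
          rw [hc]
          constructor <;> congr 1 <;> apply propext <;> omega
      · rw [if_neg (mt hcond.1 hs)]
        have := ih μ c q (a + 1) (by omega) (by omega) (by omega) (by rw [hsucc]; omega) b
        rw [this.1, this.2, hsucc]
        by_cases hb : b = a
        · subst hb
          rw [if_neg (by omega), if_neg (by omega), if_neg (by omega), if_neg (by omega)]
          exact ⟨rfl, rfl⟩
        · constructor <;> congr 1 <;> apply propext <;> omega

theorem shifts_of_contractAlg {P Q : DecoratedPerm n} {j : Fin n} (hj : P.π j ≠ j)
    (hQπ : ⇑Q.π = (contractAlg P.π P.col j).1) (hQc : Q.col = (contractAlg P.π P.col j).2) :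
    Shifts n (coord j P.π) (coord j Q.π) (coloopAt P j) (coloopAt Q j) := by
  have hj0 := cval_pos hj
  have hjn := cval_lt j (P.π j)
  have hz0 : 0 < cval j (P.π.symm j) :=
    cval_pos fun h => hj (P.π.symm_apply_eq.1 h).symm
  have hzn := cval_lt j (P.π.symm j)
  have hone : cval j (j + 1) = 1 := by
    rw [cval_add_one] <;> rw [cval_self]
    omega
  have hat : atPos j 0 = j := by rw [← cval_self j, atPos_cval]
  have hp0 : coord j P.π 0 = cval j (P.π j) := by rw [coord, hat]
  have hspec := contractLoop_spec P.π j n (Function.update (⇑P.π) j j) (Function.update P.col j 1)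
    (P.π j) (j + 1) (by omega) (by omega) (by omega)
    (by simp [hone, runMax, unwind, hp0, hj0.ne'])
  have hπ := fun b => (hspec b).1
  have hc := fun b => (hspec b).2
  change ∀ b, cval j ((contractAlg P.π P.col j).1 b) = _ at hπ
  change ∀ b, (contractAlg P.π P.col j).2 b = _ at hc
  rw [← hQπ, hone] at hπ
  rw [← hQc, hone] at hc
  have hQj : Q.π j = j := by
    have := hπ j
    rw [if_neg (by rw [cval_self]; omega), Function.update_self] at this
    exact cval_injective j this
  refine
    { lt := fun x _ => cval_lt j _
      injOn := coord_injOn j P.π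
      exists_zero := ⟨_, hzn, (coord_eq_zero_iff hzn).2 rfl⟩
      zero_ne := by omega
      map_zero := by rw [coord, hat, hQj, cval_self]
      map_pos := ?_
      not_zero := ?_
      iff := ?_
      fixed := fun x hx h => by rw [coord, h.1, cval_atPos j hx] }
  · intro x hx0 hx
    have hb := hπ (atPos j x)
    have hne : atPos j x ≠ j := fun h => by
      have := cval_atPos j hx
      rw [h, cval_self] at this
      omega
    rw [cval_atPos j hx, Function.update_of_ne hne] at hb
    change coord j Q.π x = (if _ then _ else coord j P.π x) at hb
    rw [hb]
    have hxz := coord_eq_zero_iff (π := P.π) (j := j) hx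
    by_cases hxA : x ≤ cval j (P.π.symm j)
    · by_cases hlt : runMax n (coord j P.π) x < unwind n (coord j P.π) x
      · rw [if_pos ⟨hx0, hxA, hlt⟩]
        omega
      · rw [if_neg (by tauto), min_eq_right (by omega), unwind, if_neg]
        intro h
        rw [unwind, if_pos h] at hlt
        apply hlt
        rw [runMax, Finset.sup_lt_iff (by simp; omega)]
        intro y hy
        have hy := Finset.mem_range.1 hy
        have := coord_eq_zero_iff (π := P.π) (j := j) (show y < n by omega)
        rw [unwind, if_neg (by omega)]
        exact cval_lt j _
    · rw [if_neg (by omega)]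
      have h1 := unwind_le_runMax (n := n) (p := coord j P.π) (not_le.1 hxA)
      rw [unwind, if_pos ((coord_eq_zero_iff hzn).2 rfl)] at h1
      have h2 : coord j P.π x < n := cval_lt j _
      rw [unwind, if_neg (by omega)]
      omega
  · rintro ⟨_, h⟩
    have := hc j
    rw [if_neg (by rw [cval_self]; omega), Function.update_self] at this
    rw [hat] at h
    omega
  · intro x hx0 hx
    have hb := hc (atPos j x)
    have hm := hπ (atPos j x)
    have hne : atPos j x ≠ j := fun h => by
      have := cval_atPos j hx
      rw [h, cval_self] at this
      omega
    rw [cval_atPos j hx, Function.update_of_ne hne] at hb hm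
    unfold coloopAt
    constructor
    · rintro ⟨_, h⟩
      rw [h] at hb
      split_ifs at hb
      refine ⟨?_, hb.symm⟩
      by_contra hπne
      have := P.col_nonfixed _ hπne
      omega
    · rintro ⟨h, hcol⟩
      have hpx : coord j P.π x = x := by rw [coord, h, cval_atPos j hx]
      have hux : unwind n (coord j P.π) x = x := by rw [unwind, hpx, if_neg (by omega)]
      have hle := self_le_runMax (coord_injOn j P.π) (x := x) hx.le
      rw [if_neg (by omega), h] at hm
      refine ⟨cval_injective j hm, ?_⟩
      rw [hb, if_neg, hcol]
      rintro ⟨_, hxA, heq⟩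
      obtain ⟨y, hy, hys⟩ := Finset.exists_mem_eq_sup (range x) (by simp; omega)
        (unwind n (coord j P.π))
      have hy := Finset.mem_range.1 hy
      have hyz := coord_eq_zero_iff (π := P.π) (j := j) (show y < n by omega)
      rw [unwind, if_neg (by omega)] at hys
      have hxy : coord j P.π y = coord j P.π x := by
        rw [hpx, ← hys]
        exact heq
      have := coord_injOn j P.π (Set.mem_Iio.2 (by omega : y < n)) (Set.mem_Iio.2 hx) hxy
      omega

theorem card_filter_add_card_filter_le {n : ℕ} {H : Finset (Fin n)} {j : Fin n} (hj : j ∈ H)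
    (t : Fin n) (k : ℕ) :
    #{i ∈ Hᶜ | cval t i < n - start j t + 1} + #{i ∈ Hᶜ | cval j i < start j t + k} ≤
      #Hᶜ + #{i ∈ Hᶜ | cval t i < k} := by
  rw [← Finset.card_union_add_card_inter]
  refine add_le_add (Finset.card_le_card (Finset.union_subset (Finset.filter_subset _ _)
    (Finset.filter_subset _ _))) (Finset.card_le_card fun i hi => ?_)
  simp only [Finset.mem_inter, Finset.mem_filter] at hi ⊢
  obtain ⟨⟨hiH, h1⟩, -, h2⟩ := hi
  have : NeZero n := ⟨by have := j.2; omega⟩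
  have hpos : 0 < cval j i := cval_pos fun h => Finset.mem_compl.1 hiH (h ▸ hj)
  have hun := start_le j t
  refine ⟨hiH, ?_⟩
  rw [cval_eq_cyc j t, cyc] at h1 ⊢
  split_ifs at h1 ⊢ <;> omega

end Coordinates

end PositroidContraction

open PositroidContraction

/-- correctness of the contraction algorithm: if `π(j) ≠ j` and
`(μ, col')` is the output of `contractAlg`, then `(μ, col')` is the decorated
permutation of the contraction `M/{j}`. -/
theorem contraction_algorithm_correct (n : ℕ) [NeZero n] (P : DecoratedPerm n)
    (j : Fin n) (hj : P.π j ≠ j) (Q : DecoratedPerm n)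
    (hQπ : ⇑Q.π = (contractAlg P.π P.col j).1)
    (hQc : Q.col = (contractAlg P.π P.col j).2) :
    ∀ H : Finset (Fin n),
      (∃ H' : Finset (Fin n),
          (∀ t : Fin n, galeLE t (necklaceOf P t) H') ∧ j ∈ H' ∧ H = H'.erase j) ↔
      (∀ t : Fin n, galeLE t (necklaceOf Q t) H) := by
  have hS := shifts_of_contractAlg hj hQπ hQc
  intro H
  simp only [galeLE_necklaceOf_iff]
  have hjt : ∀ t : Fin n, ∀ k, cval t j < k ↔ n < start j t + k := by
    intro t k
    have h1 := start_pos j t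
    have h2 := start_le j t
    rw [cval_eq_cyc j t, cval_self,
      cyc, if_neg (by omega)]
    omega
  have hlt : ∀ t : Fin n, ∀ k ≤ n, cval t j < k →
      nullity Q t k = nullity P t k + 1 := by
    intro t k hk h
    rw [nullity_eq_arcs Q j, nullity_eq_arcs P j]
    exact hS.arcs_of_lt (start_pos j t) (start_le j t)
      ((hjt t k).1 h) hk
  have hcard : ∀ S : Finset (Fin n), ∀ t, #{i ∈ Sᶜ | cval t i < n} = #Sᶜ := fun S t => by
    rw [Finset.filter_true_of_mem fun i _ => cval_lt t i]
  constructor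
  · rintro ⟨H', hH', hjH', rfl⟩ t
    have hcount := card_compl_insert_filter (Finset.notMem_erase j H')
    rw [Finset.insert_erase hjH'] at hcount
    refine ⟨?_, fun k hk => ?_⟩
    · have h1 := hcount t n
      rw [hcard, hcard, if_pos (cval_lt t j)] at h1
      rw [hlt t n le_rfl (cval_lt t j), (hH' t).1, h1]
    · have hk' := (hH' t).2 k hk
      rw [hcount]
      by_cases h : cval t j < k
      · rw [hlt t k hk h, if_pos h]
        omega
      · rw [if_neg h]
        have hu := start_pos j t
        have huk := mt (hjt t k).2 h
        have hQ := hS.arcs_of_le hu (not_lt.1 huk)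
        rw [← nullity_eq_arcs Q j, ← nullity_eq_arcs P j]
          at hQ
        split_ifs at hQ with hq
        · have hun := start_le j t
          have hx := hS.arcs_uncross hu (not_lt.1 huk) hq
          have hjn : ∀ l, arcs n (coord j P.π) (coloopAt P j) n l = nullity P j l := fun l => by
            rw [nullity_eq_arcs P j, start, if_pos rfl]
          rw [← nullity_eq_arcs P j, ← nullity_eq_arcs P j, hjn, hjn] at hx
          have h1 := (hH' t).2 (n - start j t + 1) (by omega)
          have h2 := (hH' j).2 (start j t + k) (by omega)
          have h3 := (hH' j).1
          have h4 := card_filter_add_card_filter_le hjH' t k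
          omega
        · omega
  · intro hH
    have hjH : j ∉ H := by
      intro hj'
      have h := (hH j).2 1 (Nat.one_le_iff_ne_zero.2 (NeZero.ne n))
      rw [hlt j 1 (Nat.one_le_iff_ne_zero.2 (NeZero.ne n))
        (by rw [cval_self]; exact one_pos), Finset.filter_false_of_mem] at h
      · simp at h
      · intro i hi hi0
        have := cval_eq_zero.1 (Nat.lt_one_iff.1 hi0)
        exact Finset.mem_compl.1 hi (this ▸ hj')
    have hcount := card_compl_insert_filter hjH
    refine ⟨insert j H, fun t => ⟨?_, fun k hk => ?_⟩, Finset.mem_insert_self j H,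
      (Finset.erase_insert hjH).symm⟩
    · have h1 := hcount t n
      have h2 := (hH t).1
      rw [hcard, hcard, if_pos (cval_lt t j)] at h1
      rw [hlt t n le_rfl (cval_lt t j)] at h2
      omega
    · have h1 := hcount t k
      have h2 := (hH t).2 k hk
      by_cases h : cval t j < k
      · rw [hlt t k hk h] at h2
        rw [if_pos h] at h1
        omega
      · rw [if_neg h] at h1
        have hQ := hS.arcs_of_le (start_pos j t)
          (not_lt.1 (mt (hjt t k).2 h))
        rw [← nullity_eq_arcs Q j, ← nullity_eq_arcs P j]
          at hQ
        omega
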